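/- Let Q be the tropical Riemann matrix of the genus-g banana graph and let a, a' be extreme points of the Voronoi polytope V_Q. Then a ~ a' (i.e. a' = a − c₀ for some c₀ ∈ 𝒟(a)) if and only if the number of indices i with (Bᵀa)_i < 0 equals the number of indices i with (Bᵀa')_i < 0; equivalently, the associated strongly connected orientations have the same number k of edges directed out of the first vertex of the banana graph. -/

import Mathlib

open Matrix

/-- The quadratic form `xᵀ Q x` associated to a `g × g` real matrix `Q`. -/
noncomputable def quadForm {g : ℕ} (Q : Matrix (Fin g) (Fin g) ℝ) (x : Fin g → ℝ) : ℝ :=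
  x ⬝ᵥ Q.mulVec x

/-- The real vector obtained from an integer vector by coordinatewise coercion. -/
def intVec {g : ℕ} (c : Fin g → ℤ) : Fin g → ℝ := fun i => (c i : ℝ)

/-- The Voronoi polytope `V_Q = {a : aᵀQa ≤ (a−c)ᵀQ(a−c) for all c ∈ ℤ^g}`. -/
def voronoiPolytope {g : ℕ} (Q : Matrix (Fin g) (Fin g) ℝ) : Set (Fin g → ℝ) :=
  {a | ∀ c : Fin g → ℤ, quadForm Q a ≤ quadForm Q (a - intVec c)}

/-- The Delaunay set `𝒟(a) = {c ∈ ℤ^g : aᵀQa = (a−c)ᵀQ(a−c)}`. -/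
def delaunaySet {g : ℕ} (Q : Matrix (Fin g) (Fin g) ℝ) (a : Fin g → ℝ) : Set (Fin g → ℤ) :=
  {c | quadForm Q a = quadForm Q (a - intVec c)}

/-- The tropical Riemann matrix of the genus-`g` banana graph: diagonal entries `2`,
off-diagonal entries `1`. -/
noncomputable def bananaQ (g : ℕ) : Matrix (Fin g) (Fin g) ℝ :=
  Matrix.of fun i j => if i = j then 2 else 1

/-- The class `[k]` of Voronoi vertices: vectors with all coordinates in
`{−k/(g+1), (g+1−k)/(g+1)}` and either `k` or `k−1` coordinates equal to `(g+1−k)/(g+1)`. -/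
def bananaClass (g k : ℕ) : Set (Fin g → ℝ) :=
  {a | (∀ i, a i = -(k : ℝ) / ((g : ℝ) + 1) ∨ a i = ((g : ℝ) + 1 - (k : ℝ)) / ((g : ℝ) + 1)) ∧
       ({i | a i = ((g : ℝ) + 1 - (k : ℝ)) / ((g : ℝ) + 1)}.ncard = k ∨
        {i | a i = ((g : ℝ) + 1 - (k : ℝ)) / ((g : ℝ) + 1)}.ncard = k - 1)}

/-- The linear map `Bᵀ : ℝ^g → ℝ^{g+1}`, where `B` is the `g × (g+1)` matrix whose `i`-th row
is `e₁ − e_{i+1}`. -/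
noncomputable def bananaBT (g : ℕ) (a : Fin g → ℝ) : Fin (g + 1) → ℝ :=
  fun j => ∑ i : Fin g,
    ((if (j : ℕ) = 0 then (1 : ℝ) else 0) - (if (j : ℕ) = (i : ℕ) + 1 then 1 else 0)) * a i

theorem BT_zero {g : ℕ} (a : Fin g → ℝ) : bananaBT g a 0 = ∑ i, a i := by
  simp [bananaBT]

theorem BT_succ {g : ℕ} (a : Fin g → ℝ) (i : Fin g) : bananaBT g a i.succ = - a i := by
  simp only [bananaBT, Fin.val_succ, Nat.add_eq_zero_iff, one_ne_zero, and_false, if_false,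
    add_left_inj, Fin.val_inj]
  simp

theorem BT_sum {g : ℕ} (a : Fin g → ℝ) : ∑ j, bananaBT g a j = 0 := by
  rw [Fin.sum_univ_succ]
  simp [BT_zero, BT_succ]

theorem BT_sub {g : ℕ} (a b : Fin g → ℝ) (j) :
    bananaBT g (a - b) j = bananaBT g a j - bananaBT g b j := by
  refine Fin.cases ?_ (fun i => ?_) j
  · simp [BT_zero]
  · simp [BT_succ]; ring

theorem BT_lift {g : ℕ} (y : Fin (g+1) → ℝ) (hy : ∑ j, y j = 0) (j) :
    bananaBT g (fun i => - y i.succ) j = y j := by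
  rw [Fin.sum_univ_succ] at hy
  refine Fin.cases ?_ (fun i => ?_) j
  · simp [BT_zero]; linarith
  · simp [BT_succ]

theorem quad_eq {g : ℕ} (a : Fin g → ℝ) :
    quadForm (bananaQ g) a = ∑ j, (bananaBT g a j) ^ 2 := by
  rw [Fin.sum_univ_succ]
  simp only [BT_zero, BT_succ]
  have h : ∀ i, (bananaQ g).mulVec a i = a i + ∑ j, a j := by
    intro i
    simp only [Matrix.mulVec, dotProduct, bananaQ, Matrix.of_apply]
    have : ∀ j, (if i = j then (2:ℝ) else 1) * a j = (if i = j then a j else 0) + a j := by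
      intro j; split_ifs <;> ring
    simp [this, Finset.sum_add_distrib]
  simp only [quadForm, dotProduct, h, mul_add, Finset.sum_add_distrib, ← Finset.sum_mul]
  simp only [sq, neg_mul_neg]
  ring

theorem BT_int {g : ℕ} (c : Fin g → ℤ) (j) : ∃ z : ℤ, bananaBT g (intVec c) j = z := by
  refine Fin.cases ?_ (fun i => ?_) j
  · exact ⟨∑ i, c i, by simp [BT_zero, intVec]⟩
  · exact ⟨- c i, by simp [BT_succ, intVec]⟩

theorem quad_sub {g : ℕ} (a b : Fin g → ℝ) :
    quadForm (bananaQ g) (a - b) = quadForm (bananaQ g) a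
      - 2 * ∑ j, bananaBT g a j * bananaBT g b j + ∑ j, (bananaBT g b j) ^ 2 := by
  simp only [quad_eq, BT_sub, Finset.mul_sum, ← Finset.sum_sub_distrib, ← Finset.sum_add_distrib]
  exact Finset.sum_congr rfl fun j _ => by ring

theorem mem_V {g : ℕ} (a : Fin g → ℝ) :
    a ∈ voronoiPolytope (bananaQ g) ↔ ∀ i j, bananaBT g a i - bananaBT g a j ≤ 1 := by
  constructor
  · intro h i j
    by_cases hij : i = j
    · subst hij; simp
    have hc := h (fun k => - ((if k.succ = i then 1 else 0) - (if k.succ = j then 1 else 0)))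
    set y : Fin (g+1) → ℝ := fun k => (if k = i then 1 else 0) - (if k = j then 1 else 0) with hy
    have e : intVec (fun k : Fin g =>
        - ((if k.succ = i then (1:ℤ) else 0) - (if k.succ = j then 1 else 0)))
        = fun k => - y k.succ := by
      funext k; simp [intVec, hy]
    have hs : ∑ k, y k = 0 := by simp [hy]
    rw [e, quad_sub] at hc
    simp only [BT_lift y hs] at hc
    have h1 : ∑ k, bananaBT g a k * y k = bananaBT g a i - bananaBT g a j := by
      simp [hy, mul_sub]
    have h2 : ∑ k, y k ^ 2 = 2 := by
      have : ∀ k, y k ^ 2 = (if k = i then 1 else 0) + (if k = j then 1 else 0) := by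
        intro k
        simp only [hy]
        by_cases h1 : k = i
        · have : k ≠ j := fun h => hij (h1 ▸ h)
          simp [h1, hij]
        · by_cases h2 : k = j <;> simp [h1, h2, Ne.symm hij]
      simp only [this, Finset.sum_add_distrib]
      simp; norm_num
    rw [h1, h2] at hc
    linarith
  · intro h c
    obtain ⟨p, hp⟩ := Finite.exists_max (bananaBT g a)
    obtain ⟨q, hq⟩ := Finite.exists_min (bananaBT g a)
    rw [quad_sub]
    set t := (bananaBT g a p + bananaBT g a q) / 2 with ht
    have h0 := BT_sum (intVec c)
    have h1 : ∑ j, bananaBT g a j * bananaBT g (intVec c) j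
        = ∑ j, (bananaBT g a j - t) * bananaBT g (intVec c) j := by
      simp only [sub_mul, Finset.sum_sub_distrib, ← Finset.mul_sum, h0]; ring
    have h2 : ∑ j, (bananaBT g a j - t) * bananaBT g (intVec c) j
        ≤ ∑ j, (bananaBT g (intVec c) j) ^ 2 / 2 := by
      refine Finset.sum_le_sum fun j _ => ?_
      obtain ⟨z, hz⟩ := BT_int c j
      rw [hz]
      have a1 : |bananaBT g a j - t| ≤ 1 / 2 := by
        rw [abs_le]
        have := h p q
        have := hp j
        have := hq j
        constructor <;> linarith
      have a2 : |(z:ℝ)| ≤ (z:ℝ) ^ 2 := by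
        have : |z| ≤ z ^ 2 := by
          rw [← sq_abs]
          rcases (abs_nonneg z).eq_or_lt with h | h
          · rw [← h]; norm_num
          · nlinarith
        exact_mod_cast this
      calc _ ≤ |(bananaBT g a j - t) * z| := le_abs_self _
        _ = |bananaBT g a j - t| * |(z:ℝ)| := abs_mul _ _
        _ ≤ 1 / 2 * (z:ℝ) ^ 2 := mul_le_mul a1 a2 (abs_nonneg _) (by norm_num)
        _ = _ := by ring
    rw [← Finset.sum_div] at h2
    linarith

theorem vert_aux {g : ℕ} (hg : 1 ≤ g) (a : Fin g → ℝ)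
    (ha : a ∈ Set.extremePoints ℝ (voronoiPolytope (bananaQ g))) (l : Fin (g+1)) :
    ∃ j, 1 ≤ |bananaBT g a l - bananaBT g a j| := by
  by_contra! hcon
  obtain ⟨p, hp⟩ := Finite.exists_max (fun j => |bananaBT g a l - bananaBT g a j|)
  have hV := (mem_V a).1 ha.1
  set ε := 1 - |bananaBT g a l - bananaBT g a p| with hε
  have hpos : 0 < ε := by have := hcon p; linarith
  have hn : (0:ℝ) < (g:ℝ) + 1 := by positivity
  set d : Fin (g+1) → ℝ := fun k => ε * ((if k = l then 1 else 0) - 1 / ((g:ℝ)+1)) with hd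
  have hs : ∑ k, d k = 0 := by
    simp only [hd, ← Finset.mul_sum, Finset.sum_sub_distrib]
    simp
    right; field_simp; ring
  set v : Fin g → ℝ := fun i => - d i.succ with hv
  have hvd : ∀ k, bananaBT g v k = d k := BT_lift d hs
  have hneg : ∀ k, bananaBT g (-v) k = - d k := by
    intro k
    have := BT_sub 0 v k
    rw [zero_sub] at this
    rw [this, hvd]
    have : bananaBT g 0 k = 0 := by simp [bananaBT]
    rw [this]; ring
  have key : ∀ s : ℝ, |s| ≤ 1 → ∀ i j, (bananaBT g a i + s * d i) - (bananaBT g a j + s * d j) ≤ 1 := by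
    intro s hs i j
    have hs' := abs_le.1 hs
    have e1 : s * ε ≤ ε := by nlinarith
    have e2 : -(s * ε) ≤ ε := by nlinarith
    have b1 := abs_le.1 (show |bananaBT g a l - bananaBT g a i| ≤ 1 - ε by have := hp i; linarith)
    have b2 := abs_le.1 (show |bananaBT g a l - bananaBT g a j| ≤ 1 - ε by have := hp j; linarith)
    have b3 := hV i j
    have : s * d i - s * d j = s * ε * ((if i = l then 1 else 0) - (if j = l then 1 else 0)) := by
      simp only [hd]; ring
    by_cases hi : i = l <;> by_cases hj : j = l
    · subst hi; subst hj; linarith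
    · simp only [hi, hj, if_true, if_false] at this b1 b2 b3 ⊢
      linarith
    · simp only [hi, hj, if_true, if_false] at this b1 b2 b3 ⊢
      linarith
    · simp only [hi, hj, if_false] at this
      linarith
  have m1 : a - v ∈ voronoiPolytope (bananaQ g) := by
    rw [mem_V]; intro i j
    rw [BT_sub, BT_sub, hvd, hvd]
    have := key (-1) (by simp) i j
    linarith
  have m2 : a - (-v) ∈ voronoiPolytope (bananaQ g) := by
    rw [mem_V]; intro i j
    rw [BT_sub, BT_sub, hneg, hneg]
    have := key 1 (by simp) i j
    linarith
  have := ha.2 m1 m2 ⟨1/2, 1/2, by norm_num, by norm_num, by norm_num, by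
    funext i; simp; ring⟩
  have hl := BT_sub a v l
  rw [this, hvd] at hl
  have h0 : d l = 0 := by linarith
  simp only [hd, if_true] at h0
  have h1 : (1:ℝ) / ((g:ℝ)+1) < 1 := by
    rw [div_lt_one hn]
    have : (1:ℝ) ≤ g := by exact_mod_cast hg
    linarith
  nlinarith

theorem vert {g : ℕ} (hg : 1 ≤ g) (a : Fin g → ℝ)
    (ha : a ∈ Set.extremePoints ℝ (voronoiPolytope (bananaQ g))) :
    0 < {i | bananaBT g a i < 0}.ncard ∧ {i | bananaBT g a i < 0}.ncard < g + 1 ∧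
    ∀ i, bananaBT g a i = ({i | bananaBT g a i < 0}.ncard : ℝ) / ((g:ℝ)+1) ∨
      bananaBT g a i = ({i | bananaBT g a i < 0}.ncard : ℝ) / ((g:ℝ)+1) - 1 := by
  have hV := (mem_V a).1 ha.1
  have haux := vert_aux hg a ha
  have hsum := BT_sum a
  set y := bananaBT g a with hy
  obtain ⟨p, hp⟩ := Finite.exists_max y
  obtain ⟨q, hq⟩ := Finite.exists_min y
  have hn : (0:ℝ) < (g:ℝ) + 1 := by positivity
  have hval : ∀ i, y i = y p ∨ y i = y p - 1 := by
    intro i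
    obtain ⟨j, hj⟩ := haux i
    have := hV i j
    have := hV j i
    have := hV p i
    have := hV p j
    have := hp i
    have := hp j
    rcases le_abs.1 hj with h | h
    · left; linarith
    · right; linarith
  have hqp : y q = y p - 1 := by
    obtain ⟨j, hj⟩ := haux p
    have := hV p q
    have := hq j
    have := hp j
    rcases le_abs.1 hj with h | h <;> linarith
  have hp0 : 0 < y p := by
    have : ∑ j, y j < ∑ j : Fin (g+1), y p :=
      Finset.sum_lt_sum (fun i _ => hp i) ⟨q, Finset.mem_univ _, by linarith⟩
    rw [hsum] at this
    simp at this
    push_cast at this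
    exact (pos_iff_pos_of_mul_pos this).1 hn
  have hq0 : y q < 0 := by
    have : ∑ j : Fin (g+1), y q < ∑ j, y j :=
      Finset.sum_lt_sum (fun i _ => hq i) ⟨p, Finset.mem_univ _, by linarith⟩
    rw [hsum] at this
    simp at this
    push_cast at this
    by_contra! h
    have := mul_nonneg hn.le h
    linarith
  have hcard : {i | y i < 0}.ncard = (Finset.univ.filter fun i => y i < 0).card := by
    rw [← Set.ncard_coe_finset]; simp
  have hM : y p = ({i | y i < 0}.ncard : ℝ) / ((g:ℝ)+1) := by
    have : ∀ i, y i = y p - (if y i < 0 then 1 else 0) := by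
      intro i
      rcases hval i with h | h
      · rw [if_neg (by linarith)]; linarith
      · rw [if_pos (by linarith)]; linarith
    rw [Finset.sum_congr rfl (fun i _ => this i), Finset.sum_sub_distrib, Finset.sum_boole,
      ← hcard] at hsum
    simp at hsum
    rw [eq_div_iff hn.ne']
    linarith
  have hm : ({i | y i < 0}.ncard : ℝ) = y p * ((g:ℝ)+1) := by
    rw [hM]; field_simp
  refine ⟨?_, ?_, ?_⟩
  · have : (0:ℝ) < ({i | y i < 0}.ncard : ℝ) := by rw [hm]; positivity
    exact_mod_cast this
  · have : ({i | y i < 0}.ncard : ℝ) < (g:ℝ)+1 := by rw [hm]; nlinarith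
    exact_mod_cast this
  · rw [← hM]; exact hval

/-- Two Voronoi vertices `a, a'` of the banana graph are equivalent (`a' = a − c₀` for some
`c₀ ∈ 𝒟(a)`) iff `Bᵀa` and `Bᵀa'` have the same number of negative coordinates,
i.e. the associated strongly connected orientations have the same number of edges directed
out of the first vertex. -/
theorem stmt10 (g : ℕ) (hg : 1 ≤ g) (a a' : Fin g → ℝ)
    (ha : a ∈ Set.extremePoints ℝ (voronoiPolytope (bananaQ g)))
    (ha' : a' ∈ Set.extremePoints ℝ (voronoiPolytope (bananaQ g))) :
    (∃ c₀ ∈ delaunaySet (bananaQ g) a, a' = a - intVec c₀) ↔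
      {i | bananaBT g a i < 0}.ncard = {i | bananaBT g a' i < 0}.ncard := by
  obtain ⟨h1, h2, h3⟩ := vert hg a ha
  obtain ⟨h1', h2', h3'⟩ := vert hg a' ha'
  generalize {i | bananaBT g a i < 0}.ncard = m at *
  generalize {i | bananaBT g a' i < 0}.ncard = m' at *
  have hn : (0:ℝ) < (g:ℝ) + 1 := by positivity
  constructor
  · rintro ⟨c, -, rfl⟩
    obtain ⟨z, hz⟩ := BT_int c 0
    have e := BT_sub a (intVec c) 0
    rw [hz] at e
    have : ∃ w : ℤ, (m:ℝ) / ((g:ℝ)+1) - (m':ℝ) / ((g:ℝ)+1) = w := by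
      rcases h3 0 with h | h <;> rcases h3' 0 with h' | h' <;> rw [h, h'] at e
      · exact ⟨z, by linarith⟩
      · exact ⟨z - 1, by push_cast; linarith⟩
      · exact ⟨z + 1, by push_cast; linarith⟩
      · exact ⟨z, by linarith⟩
    obtain ⟨w, hw⟩ := this
    rw [← sub_div, div_eq_iff hn.ne'] at hw
    have hw' : (m:ℤ) - m' = w * (g + 1) := by exact_mod_cast hw
    have w1 : w < 1 := by
      by_contra! h
      nlinarith
    have w2 : -1 < w := by
      by_contra! h
      nlinarith
    have : w = 0 := by omega
    subst this
    omega
  · rintro rfl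
    have hc : ∀ i, ∃ z : ℤ, a i - a' i = z := by
      intro i
      have e := BT_succ a i
      have e' := BT_succ a' i
      rcases h3 i.succ with h | h <;> rcases h3' i.succ with h' | h' <;>
        rw [h] at e <;> rw [h'] at e'
      · exact ⟨0, by push_cast; linarith⟩
      · exact ⟨-1, by push_cast; linarith⟩
      · exact ⟨1, by push_cast; linarith⟩
      · exact ⟨0, by push_cast; linarith⟩
    choose c hc using hc
    have hac : a' = a - intVec c := by
      funext i
      simp [intVec, ← hc]
    refine ⟨c, ?_, hac⟩
    change quadForm _ _ = quadForm _ _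
    rw [← hac]
    have key : ∀ b : Fin g → ℝ, (∀ i, bananaBT g b i = (m:ℝ) / ((g:ℝ)+1) ∨
        bananaBT g b i = (m:ℝ) / ((g:ℝ)+1) - 1) → quadForm (bananaQ g) b =
        ∑ i : Fin (g+1), - ((m:ℝ) / ((g:ℝ)+1) * ((m:ℝ) / ((g:ℝ)+1) - 1)) := by
      intro b hb
      rw [quad_eq]
      have : ∀ i, bananaBT g b i ^ 2 = (2 * ((m:ℝ) / ((g:ℝ)+1)) - 1) * bananaBT g b i
          + - ((m:ℝ) / ((g:ℝ)+1) * ((m:ℝ) / ((g:ℝ)+1) - 1)) := by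
        intro i
        rcases hb i with h | h <;> rw [h] <;> ring
      rw [Finset.sum_congr rfl (fun i _ => this i), Finset.sum_add_distrib, ← Finset.mul_sum,
        BT_sum, mul_zero, zero_add]
    rw [key a h3, key a' h3']
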